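/- Let m be a bilinear multiplier of type (p₁,p₂,p₃) such that m(tξ, tη) = m(ξ,η) for all t > 0 and all (ξ,η) ∈ ℝ², and suppose the associated bilinear operator B_m is not identically zero on 𝒫(ℝ) × 𝒫(ℝ). Then 1/p₁ + 1/p₂ = 1/p₃. -/

import Mathlib

open MeasureTheory Set ENNReal

noncomputable def FT (f : ℝ → ℂ) (ξ : ℝ) : ℂ :=
  ∫ x : ℝ, Complex.exp (-(2 * Real.pi * x * ξ) * Complex.I) * f x

noncomputable def FT2 (Φ : ℝ × ℝ → ℂ) (ξη : ℝ × ℝ) : ℂ :=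
  ∫ uv : ℝ × ℝ, Complex.exp (-(2 * Real.pi * (ξη.1 * uv.1 + ξη.2 * uv.2)) * Complex.I) * Φ uv

/-- The class `𝒫(ℝ)`: Schwartz functions whose Fourier transform has compact support. -/
def MemP (f : ℝ → ℂ) : Prop :=
  (∃ φ : SchwartzMap ℝ ℂ, ⇑φ = f) ∧ HasCompactSupport (FT f)

/-- The bilinear operator associated to a symbol `m` on `ℝ × ℝ`. -/
noncomputable def Bm (m : ℝ × ℝ → ℂ) (f g : ℝ → ℂ) (x : ℝ) : ℂ :=
  ∫ ξη : ℝ × ℝ, FT f ξη.1 * FT g ξη.2 * m ξη *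
    Complex.exp ((2 * Real.pi * (ξη.1 + ξη.2) * x) * Complex.I)

/-- `m` is a bilinear multiplier of type `(p₁, p₂, p₃)`. -/
def IsBiMult (p₁ p₂ p₃ : ℝ≥0∞) (m : ℝ × ℝ → ℂ) : Prop :=
  ∃ C : ℝ, 0 < C ∧ ∀ f g : ℝ → ℂ, MemP f → MemP g →
    eLpNorm (Bm m f g) p₃ volume ≤
      ENNReal.ofReal C * eLpNorm f p₁ volume * eLpNorm g p₂ volume

/-- The multiplier norm `‖m‖_{(p₁,p₂,p₃)}`: the least admissible constant. -/
noncomputable def biNorm (p₁ p₂ p₃ : ℝ≥0∞) (m : ℝ × ℝ → ℂ) : ℝ :=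
  sInf {C : ℝ | 0 ≤ C ∧ ∀ f g : ℝ → ℂ, MemP f → MemP g →
    eLpNorm (Bm m f g) p₃ volume ≤
      ENNReal.ofReal C * eLpNorm f p₁ volume * eLpNorm g p₂ volume}

/-- The dilation of a function on the line. -/
def dil (t : ℝ) (f : ℝ → ℂ) (x : ℝ) : ℂ := f (t * x)

theorem FT_eq_fourier (f : ℝ → ℂ) : FT f = FourierTransform.fourier f := by
  funext ξ
  rw [Real.fourier_real_eq_integral_exp_smul]
  simp only [FT, smul_eq_mul]
  congr 1; funext x; congr 2; push_cast; ring

theorem continuous_FT {f : ℝ → ℂ} (hf : MemP f) : Continuous (FT f) := by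
  obtain ⟨⟨φ, rfl⟩, -⟩ := hf
  rw [FT_eq_fourier, ← SchwartzMap.fourier_coe]
  exact SchwartzMap.continuous _

theorem FT_dil {t : ℝ} (ht : 0 < t) (f : ℝ → ℂ) (ξ : ℝ) :
    FT (dil t f) ξ = (t : ℂ)⁻¹ * FT f (t⁻¹ * ξ) := by
  have h := Measure.integral_comp_mul_left
    (fun x : ℝ => Complex.exp (-(2 * Real.pi * x * (t⁻¹ * ξ : ℝ)) * Complex.I) * f x) t
  rw [abs_of_pos (inv_pos.2 ht), Complex.real_smul, Complex.ofReal_inv] at h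
  have htc : (t : ℂ) ≠ 0 := by exact_mod_cast ht.ne'
  unfold FT
  rw [← h]
  congr 1; funext x
  simp only [dil]
  congr 2; push_cast; field_simp

theorem MemP.dil {f : ℝ → ℂ} (hf : MemP f) {t : ℝ} (ht : 0 < t) : MemP (dil t f) := by
  obtain ⟨⟨φ, rfl⟩, hc⟩ := hf
  refine ⟨⟨SchwartzMap.compCLMOfContinuousLinearEquiv ℝ
    (ContinuousLinearEquiv.unitsEquivAut ℝ (Units.mk0 t ht.ne')) φ, ?_⟩, ?_⟩
  · funext x
    simp [_root_.dil, mul_comm]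
  · have : FT (_root_.dil t φ) =
        fun ξ => (t : ℂ)⁻¹ * (FT φ ∘ Homeomorph.mulLeft₀ t⁻¹ (inv_ne_zero ht.ne')) ξ := by
      funext ξ
      simp [FT_dil ht]
    rw [this]
    exact (hc.comp_homeomorph _).mul_left

theorem MemP.eLpNorm_ne_top {f : ℝ → ℂ} (hf : MemP f) (p : ℝ≥0∞) :
    eLpNorm f p volume ≠ ∞ := by
  obtain ⟨⟨φ, rfl⟩, -⟩ := hf
  have h : MemLp φ p volume := φ.memLp p volume
  exact h.eLpNorm_ne_top

theorem eLpNorm_dil {t : ℝ} (ht : 0 < t) (f : ℝ → ℂ) (p : ℝ≥0∞) :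
    eLpNorm (dil t f) p volume =
      ENNReal.ofReal (t ^ (-(1 / p).toReal)) * eLpNorm f p volume := by
  have h := (Homeomorph.mulLeft₀ t ht.ne').measurableEmbedding.eLpNorm_map_measure
    (g := f) (μ := volume) (p := p)
  have hm := Real.map_volume_mul_left ht.ne'
  rw [Homeomorph.coe_mulLeft₀, hm, eLpNorm_smul_measure_of_ne_zero
    (by simpa using ht.ne')] at h
  rw [show dil t f = f ∘ (t * ·) from rfl, ← h, abs_of_pos (inv_pos.2 ht), smul_eq_mul,
    ENNReal.ofReal_rpow_of_pos (inv_pos.2 ht), Real.inv_rpow ht.le, Real.rpow_neg ht.le]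

theorem Bm_dil {m : ℝ × ℝ → ℂ}
    (hhom : ∀ t : ℝ, 0 < t → ∀ ξ η : ℝ, m (t * ξ, t * η) = m (ξ, η))
    {t : ℝ} (ht : 0 < t) (f g : ℝ → ℂ) : Bm m (dil t f) (dil t g) = dil t (Bm m f g) := by
  funext x
  have h := Measure.integral_comp_smul (volume : Measure (ℝ × ℝ))
    (fun ξη : ℝ × ℝ => FT f ξη.1 * FT g ξη.2 * m ξη *
      Complex.exp ((2 * Real.pi * (ξη.1 + ξη.2) * (t * x : ℝ)) * Complex.I)) t⁻¹
  have htc : (t : ℂ) ≠ 0 := by exact_mod_cast ht.ne'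
  rw [Module.finrank_prod, Module.finrank_self, inv_pow, inv_inv, abs_of_pos (by positivity),
    Complex.real_smul] at h
  simp only [dil, Bm]
  rw [← mul_right_inj' (pow_ne_zero 2 htc), ← Complex.ofReal_pow, ← one_add_one_eq_two (R := ℕ),
    ← h, ← integral_const_mul]
  congr 1; funext ⟨ξ, η⟩
  rw [FT_dil ht, FT_dil ht]
  simp only [Prod.smul_mk, smul_eq_mul]
  rw [hhom _ (inv_pos.2 ht)]
  have : (2 * Real.pi * ((t⁻¹ * ξ : ℝ) + (t⁻¹ * η : ℝ)) * (t * x : ℝ)) * Complex.I =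
      (2 * Real.pi * (ξ + η) * x) * Complex.I := by
    push_cast; field_simp
  rw [this]
  push_cast
  field_simp

theorem continuous_Bm {m : ℝ × ℝ → ℂ} (hm : LocallyIntegrable m volume) {f g : ℝ → ℂ}
    (hf : MemP f) (hg : MemP g) : Continuous (Bm m f g) := by
  have hF : Continuous fun ξη : ℝ × ℝ => FT f ξη.1 * FT g ξη.2 :=
    ((continuous_FT hf).comp continuous_fst).mul ((continuous_FT hg).comp continuous_snd)
  have hc : HasCompactSupport fun ξη : ℝ × ℝ => FT f ξη.1 * FT g ξη.2 := by
    refine HasCompactSupport.intro (hf.2.isCompact.prod hg.2.isCompact) fun ξη h => ?_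
    by_contra h0
    exact h ⟨subset_tsupport _ (left_ne_zero_of_mul h0),
      subset_tsupport _ (right_ne_zero_of_mul h0)⟩
  have hi : Integrable (fun ξη : ℝ × ℝ => FT f ξη.1 * FT g ξη.2 * m ξη) volume :=
    hm.integrable_smul_left_of_hasCompactSupport hF hc
  refine continuous_of_dominated (fun x => ?_) (fun x => ?_) hi.norm ?_
  · exact hi.aestronglyMeasurable.mul (Continuous.aestronglyMeasurable (by fun_prop))
  · refine Filter.Eventually.of_forall fun ξη => ?_
    rw [norm_mul]
    have : (2 * Real.pi * (ξη.1 + ξη.2) * x : ℂ) =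
        ((2 * Real.pi * (ξη.1 + ξη.2) * x : ℝ) : ℂ) := by push_cast; ring
    rw [this, Complex.norm_exp_ofReal_mul_I, mul_one]
  · exact Filter.Eventually.of_forall fun ξη => by fun_prop

/-- A power of a positive variable which is bounded on `(0, ∞)` has exponent zero. -/
theorem eq_zero_of_rpow_le {a K : ℝ} (h : ∀ t : ℝ, 0 < t → t ^ a ≤ K) : a = 0 := by
  by_contra ha
  have hK : 0 < K := (one_pos.trans_le (by simpa using h 1 one_pos))
  have := h ((K + 1) ^ a⁻¹) (by positivity)
  rw [← Real.rpow_mul (by positivity), inv_mul_cancel₀ ha, Real.rpow_one] at this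
  linarith

theorem stmt6 (p₁ p₂ p₃ : ℝ≥0∞) (hp₁ : 1 ≤ p₁) (hp₂ : 1 ≤ p₂) (hp₃ : 0 < p₃)
    (m : ℝ × ℝ → ℂ) (hmloc : LocallyIntegrable m volume)
    (hm : IsBiMult p₁ p₂ p₃ m)
    (hhom : ∀ t : ℝ, 0 < t → ∀ ξ η : ℝ, m (t * ξ, t * η) = m (ξ, η))
    (hne : ∃ f g : ℝ → ℂ, MemP f ∧ MemP g ∧ Bm m f g ≠ 0) :
    1 / p₁ + 1 / p₂ = 1 / p₃ := by
  obtain ⟨f, g, hf, hg, h0⟩ := hne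
  obtain ⟨C, hC, hb⟩ := hm
  have hcont := continuous_Bm hmloc hf hg
  have hN0 : eLpNorm (Bm m f g) p₃ volume ≠ 0 := by
    rw [Ne, eLpNorm_eq_zero_iff hcont.aestronglyMeasurable hp₃.ne']
    exact fun h => h0 ((hcont.ae_eq_iff_eq volume continuous_zero).1 h)
  have hf' := hf.eLpNorm_ne_top p₁
  have hg' := hg.eLpNorm_ne_top p₂
  have hNtop : eLpNorm (Bm m f g) p₃ volume ≠ ∞ :=
    ((hb f g hf hg).trans_lt (mul_lt_top (mul_lt_top ofReal_lt_top hf'.lt_top) hg'.lt_top)).ne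
  have hi₁ : 1 / p₁ ≠ ∞ := by simpa using (zero_lt_one.trans_le hp₁).ne'
  have hi₂ : 1 / p₂ ≠ ∞ := by simpa using (zero_lt_one.trans_le hp₂).ne'
  have hi₃ : 1 / p₃ ≠ ∞ := by simpa using hp₃.ne'
  rw [← toReal_eq_toReal_iff' (add_ne_top.2 ⟨hi₁, hi₂⟩) hi₃, toReal_add hi₁ hi₂,
    ← sub_eq_zero]
  refine eq_zero_of_rpow_le (K := C * (eLpNorm f p₁ volume).toReal *
    (eLpNorm g p₂ volume).toReal / (eLpNorm (Bm m f g) p₃ volume).toReal) fun t ht => ?_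
  have h := hb _ _ (hf.dil ht) (hg.dil ht)
  rw [Bm_dil hhom ht, eLpNorm_dil ht, eLpNorm_dil ht, eLpNorm_dil ht] at h
  replace h := toReal_mono (by finiteness) h
  simp only [toReal_mul, toReal_ofReal hC.le, toReal_ofReal (Real.rpow_nonneg ht.le _)] at h
  rw [le_div_iff₀ (toReal_pos hN0 hNtop)]
  have h' := mul_le_mul_of_nonneg_left h
    (Real.rpow_nonneg ht.le ((1 / p₁).toReal + (1 / p₂).toReal))
  rw [Real.rpow_neg ht.le, Real.rpow_neg ht.le, Real.rpow_neg ht.le, Real.rpow_add ht] at h'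
  rw [Real.rpow_sub ht, Real.rpow_add ht]
  have e₁ := Real.rpow_pos_of_pos ht (1 / p₁).toReal
  have e₂ := Real.rpow_pos_of_pos ht (1 / p₂).toReal
  convert h' using 1 <;> field_simp
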